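/- Let H be a complex Hilbert space, D a densely defined positive self-adjoint operator on H, and let H^∞ = ⋂_{n≥0} Dom((1+D)^n) be the subspace of smooth vectors for D. Let K and T be closable operators on H with common domain H^∞ satisfying: (a) K H^∞ ⊆ H^∞ and T H^∞ ⊆ H^∞; (b) K is symmetric, i.e. ⟨Kξ, η⟩ = ⟨ξ, Kη⟩ for all ξ, η ∈ H^∞; (c) K T ξ = T K ξ for all ξ ∈ H^∞; (d) there exists m ∈ ℕ such that for every n ∈ ℕ there exist constants c₁, c₂, c₃ ≥ 0 with ‖(1+D)^n K ξ‖ ≤ c₁‖(1+D)^{n+1} ξ‖, ‖(1+D)^n (D K − K D) ξ‖ ≤ c₂‖(1+D)^{n+1} ξ‖, and ‖(1+D)^n T ξ‖ ≤ c₃‖(1+D)^{n+m} ξ‖ for all ξ ∈ H^∞. Then the closure of K is self-adjoint, and T and K commute strongly. -/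

import Mathlib

open scoped InnerProductSpace

noncomputable section

variable {H : Type*} [NormedAddCommGroup H] [InnerProductSpace ℂ H] [CompleteSpace H]

/-- `x S ⊆ S x` for a bounded operator `x` and an unbounded operator `S`. -/
def PMapCommute (x : H →L[ℂ] H) (S : H →ₗ.[ℂ] H) : Prop :=
  ∀ ξ : S.domain, ∃ h : x (ξ : H) ∈ S.domain, S ⟨x (ξ : H), h⟩ = x (S ξ)

/-- The set of bounded operators commuting with `S` and `S*` (in the containment sense). -/
def pmapCommutant (S : H →ₗ.[ℂ] H) : Set (H →L[ℂ] H) :=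
  {x | PMapCommute x S ∧ PMapCommute x S.adjoint}

/-- The von Neumann algebra `W*(S)` generated by a closed densely defined operator `S`,
defined as the commutant of the set of bounded operators commuting with `S` and `S*`. -/
def vnGen (S : H →ₗ.[ℂ] H) : Set (H →L[ℂ] H) :=
  Set.centralizer (pmapCommutant S)

/-- Two closable densely defined operators commute strongly if every element of the
von Neumann algebra generated by the closure of the first commutes with every element of the
von Neumann algebra generated by the closure of the second. -/
def StronglyCommutes (A B : H →ₗ.[ℂ] H) : Prop :=
  ∀ a ∈ vnGen A.closure, ∀ b ∈ vnGen B.closure, Commute a b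

/-- The operator `1 + D`, with the same domain as `D`. -/
def LinearPMap.onePlus (D : H →ₗ.[ℂ] H) : H →ₗ.[ℂ] H where
  domain := D.domain
  toFun := D.domain.subtype + D.toFun

/-- `ξ` lies in the domain of the `n`-th power of the partially defined operator `A`. -/
def inIterDom (A : H →ₗ.[ℂ] H) : ℕ → H → Prop
  | 0, _ => True
  | n + 1, ξ => ∃ h : ξ ∈ A.domain, inIterDom A n (A ⟨ξ, h⟩)

open Classical in
/-- The value `A^n ξ` of the `n`-th power of the partially defined operator `A`
(with junk value `0` off the domain). -/
noncomputable def iterApp (A : H →ₗ.[ℂ] H) : ℕ → H → H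
  | 0, ξ => ξ
  | n + 1, ξ => if h : ξ ∈ A.domain then iterApp A n (A ⟨ξ, h⟩) else 0

/-- The set of smooth vectors `H^∞ = ⋂ₙ dom (1+D)ⁿ` for `D`. -/
def smoothSet (D : H →ₗ.[ℂ] H) : Set H :=
  {ξ : H | ∀ n : ℕ, inIterDom D.onePlus n ξ}

set_option linter.unusedSectionVars false

section PartialOperators

namespace LinearPMap

/-- If `A` is closed and `A + c` is bounded below with dense range, then `A + c` has an everywhere
defined bounded inverse. -/
theorem IsClosed.exists_inverse_add_smul {A : H →ₗ.[ℂ] H} (hA : A.IsClosed) (c : ℂ) {δ : ℝ}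
    (hδ : 0 < δ) (hlow : ∀ x : A.domain, δ * ‖(x : H)‖ ≤ ‖A x + c • (x : H)‖)
    (hdense : Dense (Set.range fun x : A.domain => A x + c • (x : H))) :
    ∃ B : H →L[ℂ] H, (∀ z, ∃ h : B z ∈ A.domain, A ⟨B z, h⟩ + c • B z = z) ∧
      ∀ x : A.domain, B (A x + c • (x : H)) = x := by
  have hclosed : _root_.IsClosed (A.graph : Set (H × H)) := hA
  have : CompleteSpace A.graph := hclosed.completeSpace_coe
  let f : A.graph →L[ℂ] H :=
    (ContinuousLinearMap.snd ℂ H H + c • ContinuousLinearMap.fst ℂ H H).comp A.graph.subtypeL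
  have hf : ∀ g : A.graph, f g = g.1.2 + c • g.1.1 := fun g => rfl
  have hgraph : ∀ g : A.graph, ∃ h : g.1.1 ∈ A.domain, A ⟨g.1.1, h⟩ = g.1.2 := fun g => by
    obtain ⟨y, hy, hy'⟩ := (A.mem_graph_iff).1 g.2
    exact ⟨hy ▸ y.2, by rw [← hy']; congr 1; exact Subtype.ext hy.symm⟩
  have hlow' : ∀ g : A.graph, ‖g.1.1‖ ≤ δ⁻¹ * ‖f g‖ := fun g => by
    obtain ⟨h, h'⟩ := hgraph g
    have := hlow ⟨g.1.1, h⟩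
    rw [h'] at this
    rw [inv_mul_eq_div, le_div_iff₀ hδ, mul_comm]
    exact this
  have hbound : ∀ g : A.graph, ‖g‖ ≤ (1 + (1 + ‖c‖) * δ⁻¹) * ‖f g‖ := fun g => by
    have h1 := hlow' g
    have h2 : ‖g.1.2‖ ≤ ‖f g‖ + ‖c‖ * ‖g.1.1‖ := by
      have : g.1.2 = f g - c • g.1.1 := by rw [hf]; abel
      calc ‖g.1.2‖ = ‖f g - c • g.1.1‖ := by rw [← this]
        _ ≤ _ := (norm_sub_le _ _).trans_eq (by rw [norm_smul])
    have h3 : ‖c‖ * ‖g.1.1‖ ≤ ‖c‖ * (δ⁻¹ * ‖f g‖) := by gcongr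
    have h4 : 0 ≤ ‖f g‖ := norm_nonneg _
    have h5 : 0 ≤ ‖c‖ * (δ⁻¹ * ‖f g‖) := by positivity
    have h6 : 0 ≤ δ⁻¹ * ‖f g‖ := by positivity
    change ‖g.1‖ ≤ _
    rw [Prod.norm_def]
    refine max_le ?_ ?_ <;> nlinarith
  obtain ⟨K, hK⟩ : ∃ K : NNReal, AntilipschitzWith K f :=
    ⟨⟨1 + (1 + ‖c‖) * δ⁻¹, by positivity⟩,
      AddMonoidHomClass.antilipschitz_of_bound f hbound⟩
  have hker : f.ker = ⊥ := LinearMap.ker_eq_bot.2 hK.injective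
  have hrange : f.range = ⊤ := by
    have h1 : _root_.IsClosed (Set.range f) := hK.isClosed_range f.uniformContinuous
    have h2 : Dense (Set.range f) := by
      refine hdense.mono ?_
      rintro _ ⟨x, rfl⟩
      exact ⟨⟨((x : H), A x), A.mem_graph x⟩, rfl⟩
    exact LinearMap.range_eq_top.2 (Set.range_eq_univ.1 (h1.closure_eq.symm.trans h2.closure_eq))
  let e := ContinuousLinearEquiv.ofBijective f hker hrange
  refine ⟨(ContinuousLinearMap.fst ℂ H H).comp (A.graph.subtypeL.comp (e.symm : H →L[ℂ] A.graph)),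
    fun z => ?_, fun x => ?_⟩
  · obtain ⟨h, h'⟩ := hgraph (e.symm z)
    refine ⟨h, ?_⟩
    have := ContinuousLinearEquiv.ofBijective_apply_symm_apply f hker hrange z
    rw [hf] at this
    exact (congrArg (· + c • (e.symm z).1.1) h').trans this
  · have := ContinuousLinearEquiv.ofBijective_symm_apply_apply f hker hrange
      ⟨((x : H), A x), A.mem_graph x⟩
    exact congrArg (fun g : A.graph => g.1.1) this

/-- A property closed in the graph topology passes from `A` to its closure. -/
theorem IsClosable.closure_induction {A : H →ₗ.[ℂ] H} (hA : A.IsClosable) {p : H × H → Prop}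
    (hp : _root_.IsClosed {z | p z}) (h : ∀ x : A.domain, p ((x : H), A x))
    (x : A.closure.domain) : p ((x : H), A.closure x) := by
  have hx : ((x : H), A.closure x) ∈ _root_.closure (A.graph : Set (H × H)) := by
    have := A.closure.mem_graph x
    rw [← hA.graph_closure_eq_closure_graph] at this
    exact this
  refine closure_minimal (t := {z | p z}) ?_ hp hx
  rintro z hz
  obtain ⟨y, hy, hy'⟩ := (A.mem_graph_iff).1 hz
  have := h y
  rwa [hy, hy'] at this

theorem exists_apply_eq_of_mem_graph {A : H →ₗ.[ℂ] H} {x y : H} (h : (x, y) ∈ A.graph) :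
    ∃ hx : x ∈ A.domain, A ⟨x, hx⟩ = y := by
  obtain ⟨z, hz, hz'⟩ := (A.mem_graph_iff).1 h
  dsimp only at hz hz'
  subst hz
  exact ⟨z.2, hz'⟩

theorem closure_isFormalAdjoint_self {A : H →ₗ.[ℂ] H} (hA : A.IsClosable)
    (h : A.IsFormalAdjoint A) : A.closure.IsFormalAdjoint A.closure := by
  have h1 : ∀ (y : A.domain) (x : A.closure.domain),
      inner ℂ (A.closure x) (y : H) = inner ℂ (x : H) (A y) := fun y =>
    hA.closure_induction (p := fun z => inner ℂ z.2 (y : H) = inner ℂ z.1 (A y))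
      (isClosed_eq (by fun_prop) (by fun_prop)) fun x => h x y
  intro x
  exact hA.closure_induction (p := fun z => inner ℂ (A.closure x) z.1 = inner ℂ (x : H) z.2)
    (isClosed_eq (by fun_prop) (by fun_prop)) fun y => h1 y x

/-- A symmetric operator is bounded below away from the real axis. -/
theorem IsFormalAdjoint.mul_norm_le {A : H →ₗ.[ℂ] H} (h : A.IsFormalAdjoint A) (μ : ℝ)
    (x : A.domain) : |μ| * ‖(x : H)‖ ≤ ‖A x + (μ * Complex.I : ℂ) • (x : H)‖ := by
  have him : (inner ℂ (x : H) (A x)).im = 0 := by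
    have h1 := congrArg Complex.im (h x x)
    rw [← inner_conj_symm, Complex.conj_im] at h1
    linarith
  have h2 : (inner ℂ (x : H) (A x + (μ * Complex.I : ℂ) • (x : H))).im = μ * ‖(x : H)‖ ^ 2 := by
    rw [inner_add_right, inner_smul_right, inner_self_eq_norm_sq_to_K]
    simp [him, ← Complex.ofReal_pow]
  have h3 := (Complex.abs_im_le_norm _).trans
    (norm_inner_le_norm (𝕜 := ℂ) (x : H) (A x + (μ * Complex.I : ℂ) • (x : H)))
  rw [h2, abs_mul, abs_of_nonneg (sq_nonneg ‖(x : H)‖)] at h3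
  rcases (norm_nonneg (x : H)).eq_or_lt with h0 | h0
  · rw [← h0]; simp
  · nlinarith

/-- A closed symmetric operator with `A ± iμ` having dense range is self-adjoint. -/
theorem IsFormalAdjoint.isSelfAdjoint {A : H →ₗ.[ℂ] H} (h : A.IsFormalAdjoint A)
    (hd : Dense (A.domain : Set H)) {c : ℂ}
    (hr : ∀ z, ∃ x : A.domain, A x + c • (x : H) = z)
    (hr' : Dense (Set.range fun x : A.domain => A x + star c • (x : H))) :
    IsSelfAdjoint A := by
  have hle : A ≤ A.adjoint := IsFormalAdjoint.le_adjoint hd h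
  refine isSelfAdjoint_def.2 (le_antisymm ?_ hle)
  have hdom : A.adjoint.domain ≤ A.domain := by
    intro y hy
    obtain ⟨x, hx⟩ := hr (A.adjoint ⟨y, hy⟩ + c • y)
    have key : y - x = 0 := by
      refine hr'.eq_zero_of_inner_left ℂ ?_
      rintro _ ⟨w, rfl⟩
      have e1 := adjoint_isFormalAdjoint hd ⟨y, hy⟩ w
      have e2 := h x w
      have e3 := congrArg (fun t => inner ℂ t (w : H)) hx
      simp only [inner_add_left, inner_smul_left] at e3
      simp only [inner_add_right, inner_smul_right, inner_sub_left]
      dsimp only at e1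
      rw [← e1, ← e2]
      simp only [Complex.star_def]
      linear_combination -e3
    rw [sub_eq_zero] at key
    rw [key]; exact x.2
  exact ⟨hdom, fun x y hxy => (hle.2 hxy.symm).symm⟩

end LinearPMap

end PartialOperators

section EnergyEstimates

variable {S : Submodule ℂ H} {N K : Module.End ℂ S}

/-- If `[N, K]` is bounded relative to `N` on the whole scale of `N`, then `[Nᵏ, K]` is bounded
relative to `Nᵏ`. -/
theorem exists_norm_pow_commutator_le
    (hNK : ∀ n : ℕ, ∃ c : ℝ, ∀ x, ‖(N ^ n) (N (K x) - K (N x))‖ ≤ c * ‖(N ^ (n + 1)) x‖)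
    (k : ℕ) : ∃ C : ℝ, ∀ x, ‖(N ^ k) (K x) - K ((N ^ k) x)‖ ≤ C * ‖(N ^ k) x‖ := by
  induction k with
  | zero => exact ⟨0, fun x => by simp⟩
  | succ k ih =>
    obtain ⟨C, hC⟩ := ih
    obtain ⟨c, hc⟩ := hNK k
    refine ⟨c + C, fun x => ?_⟩
    have h1 := hc x
    have h2 := hC (N x)
    have h3 : ∀ y, (N ^ (k + 1)) y = (N ^ k) (N y) := fun y => by
      rw [pow_succ, Module.End.mul_apply]
    have h4 : (N ^ (k + 1)) (K x) - K ((N ^ (k + 1)) x)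
        = (N ^ k) (N (K x) - K (N x)) + ((N ^ k) (K (N x)) - K ((N ^ k) (N x))) := by
      rw [h3, h3, map_sub]; abel
    rw [h4, add_mul]
    rw [← h3 x] at h2
    refine (norm_add_le _ _).trans (add_le_add h1 ?_)
    rwa [← h3 x]

theorem im_inner_self_eq_zero_of_symm (hK : ∀ x y : S, inner ℂ (K x) y = inner ℂ x (K y)) (x : S) :
    (inner ℂ x (K x)).im = 0 := by
  have h1 := congrArg Complex.im (hK x x)
  rw [← inner_conj_symm, Complex.conj_im] at h1
  linarith

theorem exists_abs_im_inner_pow_le (hK : ∀ x y : S, inner ℂ (K x) y = inner ℂ x (K y))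
    (hNK : ∀ n : ℕ, ∃ c : ℝ, ∀ x, ‖(N ^ n) (N (K x) - K (N x))‖ ≤ c * ‖(N ^ (n + 1)) x‖)
    (k : ℕ) :
    ∃ C : ℝ, ∀ x, |(inner ℂ ((N ^ k) x) ((N ^ k) (K x))).im| ≤ C * ‖(N ^ k) x‖ ^ 2 := by
  obtain ⟨C, hC⟩ := exists_norm_pow_commutator_le hNK k
  refine ⟨C, fun x => ?_⟩
  have h1 : (inner ℂ ((N ^ k) x) ((N ^ k) (K x))).im
      = (inner ℂ ((N ^ k) x) ((N ^ k) (K x) - K ((N ^ k) x))).im := by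
    rw [inner_sub_right, Complex.sub_im, im_inner_self_eq_zero_of_symm hK, sub_zero]
  rw [h1]
  calc _ ≤ ‖(N ^ k) x‖ * ‖(N ^ k) (K x) - K ((N ^ k) x)‖ :=
        (Complex.abs_im_le_norm _).trans (norm_inner_le_norm _ _)
    _ ≤ ‖(N ^ k) x‖ * (C * ‖(N ^ k) x‖) := by gcongr; exact hC x
    _ = _ := by ring

/-- Commutator theorem: away from a strip around the real axis, the range of `K + iμ` is dense for
the graph norm of `Nᵐ`. -/
theorem exists_forall_dense_range_pow (hS : Dense (S : Set H))
    (hN : ∀ x y : S, inner ℂ (N x) y = inner ℂ x (N y)) (hNsurj : Function.Surjective N)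
    (hK : ∀ x y : S, inner ℂ (K x) y = inner ℂ x (K y))
    (hNlow : ∀ x, ‖x‖ ≤ ‖N x‖)
    (hKb : ∀ n : ℕ, ∃ c : ℝ, ∀ x, ‖(N ^ n) (K x)‖ ≤ c * ‖(N ^ (n + 1)) x‖)
    (hNK : ∀ n : ℕ, ∃ c : ℝ, ∀ x, ‖(N ^ n) (N (K x) - K (N x))‖ ≤ c * ‖(N ^ (n + 1)) x‖)
    (m : ℕ) : ∃ C : ℝ, ∀ μ : ℝ, C < |μ| →
      Dense (Set.range fun x : S => (((N ^ m) (K x + (μ * Complex.I : ℂ) • x) : S) : H)) := by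
  obtain ⟨C, hC⟩ := exists_abs_im_inner_pow_le hK hNK (m + 1)
  obtain ⟨c, hc⟩ := hKb m
  refine ⟨C, fun μ hμ => ?_⟩
  have hNpow : ∀ y, (N ^ (m + 1)) y = N ((N ^ m) y) := fun y => by
    rw [pow_succ', Module.End.mul_apply]
  let L : S →ₗ[ℂ] H :=
    S.subtype ∘ₗ (N ^ m) ∘ₗ (K + (μ * Complex.I : ℂ) • (LinearMap.id : S →ₗ[ℂ] S))
  change Dense (LinearMap.range L : Set H)
  rw [← Submodule.dense_iff_topologicalClosure_eq_top.symm.eq,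
    Submodule.topologicalClosure_eq_top_iff, Submodule.eq_bot_iff]
  intro u hu
  have hu' : ∀ x : S, inner ℂ u ((N ^ m) (K x + (μ * Complex.I : ℂ) • x) : H) = 0 := fun x =>
    Submodule.inner_left_of_mem_orthogonal (LinearMap.mem_range_self L x) hu
  set M : ℝ := |c| + |μ| with hM
  have hM0 : 0 ≤ M := by positivity
  have hest : ∀ x : S, (|μ| - C) * ‖(N ^ (m + 1)) x‖
      ≤ M * ‖((N ((N ^ (m + 1)) x) : S) : H) - u‖ := fun x => by
    set p := (N ^ (m + 1)) x with hp
    set q := (N ^ m) (K x + (μ * Complex.I : ℂ) • x) with hq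
    have hq_norm : ‖q‖ ≤ M * ‖p‖ := by
      rw [hq, map_add, map_smul, hM, add_mul]
      refine (norm_add_le _ _).trans (add_le_add ((hc x).trans ?_) ?_)
      · rw [← hp]; gcongr; exact le_abs_self c
      rw [norm_smul]
      have : ‖(N ^ m) x‖ ≤ ‖p‖ := by rw [hp, hNpow]; exact hNlow _
      simpa using mul_le_mul_of_nonneg_left this (abs_nonneg μ)
    have h1 : inner ℂ (N p) q = inner ℂ p ((N ^ (m + 1)) (K x)) + (μ * Complex.I) * (‖p‖ : ℂ) ^ 2 := by
      rw [hN, hq, ← hNpow, map_add, map_smul, ← hp, inner_add_right, inner_smul_right,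
        inner_self_eq_norm_sq_to_K]
      rfl
    have h2 : (inner ℂ (N p) q).im
        = (inner ℂ p ((N ^ (m + 1)) (K x))).im + μ * ‖p‖ ^ 2 := by
      rw [h1]; simp [← Complex.ofReal_pow]
    have h3 : |(inner ℂ (N p) q).im| ≤ ‖((N p : S) : H) - u‖ * ‖q‖ := by
      have : inner ℂ (N p) q = inner ℂ (((N p : S) : H) - u) (q : H) := by
        rw [inner_sub_left, hu' x, sub_zero]; rfl
      rw [this]
      exact (Complex.abs_im_le_norm _).trans (norm_inner_le_norm _ _)
    have h4 := hC x
    rw [← hp] at h4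
    have h5 : |μ| * ‖p‖ ^ 2 ≤ |(inner ℂ (N p) q).im| + C * ‖p‖ ^ 2 := by
      have : |μ| * ‖p‖ ^ 2 = |μ * ‖p‖ ^ 2| := by rw [abs_mul, abs_of_nonneg (sq_nonneg ‖p‖)]
      rw [this, eq_sub_of_add_eq' h2.symm]
      exact (abs_sub _ _).trans (add_le_add le_rfl h4)
    have h6 : ‖((N p : S) : H) - u‖ * ‖q‖ ≤ ‖((N p : S) : H) - u‖ * (M * ‖p‖) := by gcongr
    rcases (norm_nonneg p).eq_or_lt with h0 | h0
    · rw [← h0, mul_zero]; positivity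
    · refine le_of_mul_le_mul_right ?_ h0
      nlinarith
  have hgap : 0 < |μ| - C := sub_pos.2 hμ
  refine hS.eq_zero_of_inner_left ℂ fun s hs => ?_
  lift s to S using hs
  have hclose : ∀ w : H, ‖inner ℂ u (s : H)‖ ≤ (‖s‖ + M / (|μ| - C) * ‖N s‖) * ‖w - u‖ := by
    refine hS.induction (fun w hw => ?_) (isClosed_le (by fun_prop) (by fun_prop))
    lift w to S using hw
    obtain ⟨y, rfl⟩ := hNsurj w
    obtain ⟨x, rfl⟩ : ∃ x, (N ^ (m + 1)) x = y := by
      rw [Module.End.coe_pow]; exact hNsurj.iterate (m + 1) y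
    set p := (N ^ (m + 1)) x
    have h1 : inner ℂ u (s : H) = inner ℂ p (N s) - inner ℂ (((N p : S) : H) - u) (s : H) := by
      rw [inner_sub_left, ← hN]
      change _ = inner ℂ ((N p : S) : H) (s : H) - _
      ring
    have h2 : ‖p‖ ≤ M / (|μ| - C) * ‖((N p : S) : H) - u‖ := by
      rw [div_mul_eq_mul_div, le_div_iff₀ hgap, mul_comm]
      exact hest x
    rw [h1]
    calc _ ≤ ‖p‖ * ‖N s‖ + ‖((N p : S) : H) - u‖ * ‖s‖ :=
          (norm_sub_le _ _).trans (add_le_add (norm_inner_le_norm _ _) (norm_inner_le_norm _ _))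
      _ ≤ M / (|μ| - C) * ‖((N p : S) : H) - u‖ * ‖N s‖ + ‖((N p : S) : H) - u‖ * ‖s‖ := by
          gcongr
      _ = _ := by ring
  simpa using hclose u

end EnergyEstimates

section SmoothVectors

/-- The vectors infinitely often in the range of an injective self-adjoint bounded operator are
dense. -/
theorem dense_setOf_forall_mem_range_pow {R : H →L[ℂ] H} (hR : IsSelfAdjoint R)
    (hd : Dense (Set.range R)) : Dense {y : H | ∀ n : ℕ, ∃ u, (R ^ n) u = y} := by
  have hcut : ∀ ε : ℝ, 0 < ε → ∀ v, ∃ y, (∀ n : ℕ, ∃ u, (R ^ n) u = y) ∧ ‖y - R v‖ ≤ ε * ‖v‖ := by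
    intro ε hε v
    let clamp : ℝ → ℝ := fun x => max (-ε) (min x ε)
    have hclamp : Continuous clamp := by fun_prop
    let cut : ℝ → ℝ := fun x => x - clamp x
    have hcut : Continuous cut := by fun_prop
    refine ⟨cfc cut R v, fun n => ?_, ?_⟩
    · have hpos : ∀ x : ℝ, max (x ^ 2) (ε ^ 2) ^ n ≠ 0 := fun x => by
        have : 0 < ε ^ 2 := by positivity
        exact (pow_pos (lt_max_of_lt_right this) n).ne'
      let g : ℝ → ℝ := fun x => x ^ n * (cut x / max (x ^ 2) (ε ^ 2) ^ n)
      have hg : Continuous g :=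
        (continuous_pow n).mul (hcut.div₀ (by fun_prop) hpos)
      have hfac : cut = fun x => x ^ n * g x := by
        funext x
        by_cases hx : |x| ≤ ε
        · have hx' := abs_le.1 hx
          have h0 : cut x = 0 := by
            simp [cut, clamp, min_eq_left hx'.2, max_eq_right hx'.1]
          simp [g, h0]
        · have hx2 : ε ^ 2 ≤ x ^ 2 := by
            rw [← sq_abs x]; gcongr; exact (not_le.1 hx).le
          have h1 := hpos x
          rw [max_eq_left hx2] at h1
          simp only [g, max_eq_left hx2]
          rw [← pow_mul] at h1 ⊢
          field_simp
          ring
      refine ⟨cfc g R v, ?_⟩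
      conv_rhs => rw [hfac]
      rw [cfc_mul (fun x : ℝ => x ^ n) g R (by fun_prop) hg.continuousOn,
        cfc_pow_id R n hR]
      rfl
    · have h1 : cfc cut R - R = - cfc clamp R := by
        rw [cfc_sub (fun x : ℝ => x) clamp R (by fun_prop) hclamp.continuousOn, cfc_id' ℝ R hR]
        abel
      have h2 : ‖cfc clamp R‖ ≤ ε := norm_cfc_le hε.le fun x _ => by
        rw [Real.norm_eq_abs, abs_le]
        exact ⟨le_max_left _ _, max_le (by linarith) (min_le_right _ _)⟩
      rw [← sub_apply, h1, neg_apply, norm_neg]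
      exact ContinuousLinearMap.le_of_opNorm_le _ h2 v
  refine dense_closure.1 (hd.mono ?_)
  rintro _ ⟨v, rfl⟩
  refine Metric.mem_closure_iff.2 fun ε hε => ?_
  obtain ⟨y, hy, hyv⟩ := hcut (ε / (‖v‖ + 1)) (by positivity) v
  refine ⟨y, hy, ?_⟩
  rw [dist_comm, dist_eq_norm]
  refine hyv.trans_lt ?_
  rw [div_mul_eq_mul_div, div_lt_iff₀ (by positivity)]
  nlinarith [norm_nonneg v]

variable {D : H →ₗ.[ℂ] H}

theorem norm_le_norm_onePlus
    (hpos : ∀ ξ : D.domain, 0 ≤ (inner (𝕜 := ℂ) (ξ : H) (D ξ)).re) (x : D.domain) :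
    ‖(x : H)‖ ≤ ‖D x + (1 : ℂ) • (x : H)‖ := by
  have h1 : ‖(x : H)‖ ^ 2 ≤ (inner ℂ (x : H) (D x + (1 : ℂ) • (x : H))).re := by
    rw [inner_add_right, one_smul, inner_self_eq_norm_sq_to_K, Complex.add_re]
    have := hpos x
    simpa [← Complex.ofReal_pow] using this
  have h2 := (Complex.re_le_norm _).trans
    (norm_inner_le_norm (𝕜 := ℂ) (x : H) (D x + (1 : ℂ) • (x : H)))
  rcases (norm_nonneg (x : H)).eq_or_lt with h0 | h0
  · rw [← h0]; positivity
  · nlinarith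

/-- For a positive self-adjoint `D`, the operator `1 + D` has a self-adjoint bounded inverse. -/
theorem exists_inverse_onePlus (hd : Dense (D.domain : Set H)) (hsa : IsSelfAdjoint D)
    (hpos : ∀ ξ : D.domain, 0 ≤ (inner (𝕜 := ℂ) (ξ : H) (D ξ)).re) :
    ∃ R : H →L[ℂ] H, IsSelfAdjoint R ∧ Dense (Set.range R) ∧
      ∀ z, ∃ h : R z ∈ D.onePlus.domain, D.onePlus ⟨R z, h⟩ = z := by
  have hsymm : D.IsFormalAdjoint D := by
    have := LinearPMap.adjoint_isFormalAdjoint hd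
    rwa [LinearPMap.isSelfAdjoint_def.1 hsa] at this
  have hdense : Dense (Set.range fun x : D.domain => D x + (1 : ℂ) • (x : H)) := by
    let L : D.domain →ₗ[ℂ] H := D.toFun + (1 : ℂ) • D.domain.subtype
    change Dense (LinearMap.range L : Set H)
    rw [← Submodule.dense_iff_topologicalClosure_eq_top.symm.eq,
      Submodule.topologicalClosure_eq_top_iff, Submodule.eq_bot_iff]
    intro u hu
    have hu' : ∀ x : D.domain, inner ℂ u (D x + (1 : ℂ) • (x : H)) = 0 := fun x =>
      Submodule.inner_left_of_mem_orthogonal (LinearMap.mem_range_self L x) hu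
    have hadj : ∀ x : D.domain, inner ℂ (-u) (x : H) = inner ℂ u (D x) := fun x => by
      have := hu' x
      rw [inner_add_right, one_smul] at this
      rw [inner_neg_left]
      linear_combination -this
    have hmem : u ∈ D.adjoint.domain :=
      LinearPMap.mem_adjoint_domain_of_exists u ⟨-u, hadj⟩
    rw [LinearPMap.isSelfAdjoint_def.1 hsa] at hmem
    have hDu : D ⟨u, hmem⟩ = -u := hd.eq_of_inner_left ℂ fun x hx => by
      rw [hadj ⟨x, hx⟩]; exact hsymm ⟨u, hmem⟩ ⟨x, hx⟩
    have := norm_le_norm_onePlus hpos ⟨u, hmem⟩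
    rw [hDu, one_smul, neg_add_cancel, norm_zero] at this
    exact norm_le_zero_iff.1 this
  obtain ⟨R, hR, hR'⟩ := hsa.isClosed.exists_inverse_add_smul 1 one_pos
    (fun x => by rw [one_mul]; exact norm_le_norm_onePlus hpos x) hdense
  refine ⟨R, ?_, ?_, fun z => ?_⟩
  · rw [ContinuousLinearMap.isSelfAdjoint_iff_isSymmetric]
    intro x y
    obtain ⟨hx, hx'⟩ := hR x
    obtain ⟨hy, hy'⟩ := hR y
    have := hsymm ⟨R x, hx⟩ ⟨R y, hy⟩
    change inner ℂ (R x) y = inner ℂ x (R y)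
    have hx2 := congrArg (inner ℂ · (R y)) hx'
    have hy2 := congrArg (inner ℂ (R x) ·) hy'
    simp only [one_smul, inner_add_left, inner_add_right] at hx2 hy2
    linear_combination hx2 - hy2 - this
  · exact hd.mono fun x hx => ⟨_, hR' ⟨x, hx⟩⟩
  · obtain ⟨h, h'⟩ := hR z
    refine ⟨h, ?_⟩
    rw [one_smul, add_comm] at h'
    exact h'

theorem inIterDom_pow_apply {A : H →ₗ.[ℂ] H} {R : H →L[ℂ] H}
    (hR : ∀ z, ∃ h : R z ∈ A.domain, A ⟨R z, h⟩ = z) (n : ℕ) (u : H) :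
    inIterDom A n ((R ^ n) u) := by
  induction n with
  | zero => trivial
  | succ n ih =>
    obtain ⟨h, h'⟩ := hR ((R ^ n) u)
    rw [pow_succ']
    exact ⟨h, h'.symm ▸ ih⟩

theorem mem_domain_of_mem_smoothSet {x : H} (hx : x ∈ smoothSet D) : x ∈ D.domain := (hx 1).1

theorem onePlus_mem_smoothSet {x : H} (hx : x ∈ smoothSet D) (h : x ∈ D.onePlus.domain) :
    D.onePlus ⟨x, h⟩ ∈ smoothSet D := fun n => (hx (n + 1)).2

theorem mem_smoothSet_of_onePlus {x : H} (h : x ∈ D.onePlus.domain)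
    (hx : D.onePlus ⟨x, h⟩ ∈ smoothSet D) : x ∈ smoothSet D
  | 0 => trivial
  | n + 1 => ⟨h, hx n⟩

end SmoothVectors

section StrongCommutation

/-- A bounded operator commuting with a resolvent of `A` commutes with `A`. -/
theorem PMapCommute.of_commute_inverse {A : H →ₗ.[ℂ] H} {c : ℂ} {B a : H →L[ℂ] H}
    (hB : ∀ z, ∃ h : B z ∈ A.domain, A ⟨B z, h⟩ + c • B z = z)
    (hB' : ∀ x : A.domain, B (A x + c • (x : H)) = x) (h : ∀ z, a (B z) = B (a z)) :
    PMapCommute a A := by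
  intro x
  obtain ⟨hz, hz'⟩ := hB (a (A x + c • (x : H)))
  have hx : B (a (A x + c • (x : H))) = a x := by rw [← h, hB']
  refine ⟨hx ▸ hz, ?_⟩
  simp only [hx] at hz'
  exact add_right_cancel (hz'.trans (by rw [map_add, map_smul]))

theorem PMapCommute.adjoint {A : H →ₗ.[ℂ] H} (hA : Dense (A.domain : Set H)) {B B' : H →L[ℂ] H}
    (h : PMapCommute B' A) (hB : ∀ u v, inner ℂ (B u) v = inner ℂ u (B' v)) :
    PMapCommute B A.adjoint := by
  intro y
  have key : ∀ x : A.domain, inner ℂ (B (A.adjoint y)) (x : H) = inner ℂ (B y) (A x) := fun x => by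
    obtain ⟨hx, hx'⟩ := h x
    rw [hB, hB, ← hx']
    exact LinearPMap.adjoint_isFormalAdjoint hA y ⟨_, hx⟩
  have hmem := LinearPMap.mem_adjoint_domain_of_exists (B y) ⟨_, key⟩
  exact ⟨hmem, LinearPMap.adjoint_apply_eq hA ⟨_, hmem⟩ key⟩

theorem PMapCommute.closure {A : H →ₗ.[ℂ] H} (hA : A.IsClosable) {B : H →L[ℂ] H}
    (h : ∀ x : A.domain,
      ((x : H), A x) ∈ closure {z : H × H | (B z.1, B z.2) ∈ (A.graph : Set (H × H))}) :
    PMapCommute B A.closure := by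
  have hcont : Continuous fun z : H × H => (B z.1, B z.2) := by fun_prop
  intro x
  refine LinearPMap.exists_apply_eq_of_mem_graph ?_
  rw [← hA.graph_closure_eq_closure_graph]
  refine hA.closure_induction (p := fun z => (B z.1, B z.2) ∈ A.graph.topologicalClosure)
    (A.graph.isClosed_topologicalClosure.preimage hcont) (fun x => ?_) x
  refine closure_minimal (fun z hz => ?_)
    (A.graph.isClosed_topologicalClosure.preimage hcont) (h x)
  exact A.graph.le_topologicalClosure hz

/-- An endomorphism of a subspace, as a partially defined operator. -/
def Module.End.toLinearPMap {S : Submodule ℂ H} (A : Module.End ℂ S) : H →ₗ.[ℂ] H where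
  domain := S
  toFun := S.subtype ∘ₗ A

variable {S : Submodule ℂ H} {N K T : Module.End ℂ S}

theorem isSelfAdjoint_closure_and_stronglyCommutes (hS : Dense (S : Set H))
    (hN : ∀ x y : S, inner ℂ (N x) y = inner ℂ x (N y)) (hNsurj : Function.Surjective N)
    (hNlow : ∀ x, ‖x‖ ≤ ‖N x‖)
    (hK : ∀ x y : S, inner ℂ (K x) y = inner ℂ x (K y))
    (hKb : ∀ n : ℕ, ∃ c : ℝ, ∀ x, ‖(N ^ n) (K x)‖ ≤ c * ‖(N ^ (n + 1)) x‖)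
    (hNK : ∀ n : ℕ, ∃ c : ℝ, ∀ x, ‖(N ^ n) (N (K x) - K (N x))‖ ≤ c * ‖(N ^ (n + 1)) x‖)
    (hKT : ∀ x, K (T x) = T (K x)) {m : ℕ} {c : ℝ} (hT : ∀ x, ‖T x‖ ≤ c * ‖(N ^ m) x‖)
    (hKc : K.toLinearPMap.IsClosable) (hTc : T.toLinearPMap.IsClosable) :
    IsSelfAdjoint K.toLinearPMap.closure ∧ StronglyCommutes T.toLinearPMap K.toLinearPMap := by
  obtain ⟨C, hC⟩ := exists_forall_dense_range_pow hS hN hNsurj hK hNlow hKb hNK m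
  have hNpow : ∀ (k : ℕ) x, ‖x‖ ≤ ‖(N ^ k) x‖ := fun k => by
    induction k with
    | zero => exact fun x => le_rfl
    | succ k ih =>
      intro x
      rw [pow_succ, Module.End.mul_apply]
      exact (hNlow x).trans (ih _)
  set Kc := K.toLinearPMap.closure with hKc_def
  have hle : K.toLinearPMap ≤ Kc := LinearPMap.le_closure _
  have hKmem : ∀ x : S, (x : H) ∈ Kc.domain := fun x => hle.1 x.2
  have hKapp : ∀ x : S, Kc ⟨x, hKmem x⟩ = K x := fun x =>
    (hle.2 (x := x) (y := ⟨x, hKmem x⟩) rfl).symm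
  have hsymm : Kc.IsFormalAdjoint Kc :=
    LinearPMap.closure_isFormalAdjoint_self hKc fun x y => hK x y
  have hdom : Dense (Kc.domain : Set H) := hS.mono hle.1
  -- every vector of `S` is approximated, in the norm of `N ^ m`, by the range of `K + iμ`
  have happrox : ∀ μ : ℝ, C < |μ| → ∀ (x : S) (ε : ℝ), 0 < ε →
      ∃ y : S, ‖(N ^ m) (K y + (μ * Complex.I : ℂ) • y - x)‖ < ε := fun μ hμ x ε hε => by
    obtain ⟨_, ⟨y, rfl⟩, hy⟩ := (hC μ hμ).exists_dist_lt ((N ^ m) x : S) hε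
    refine ⟨y, ?_⟩
    rw [dist_comm, dist_eq_norm] at hy
    rw [map_sub]
    exact hy
  have hdense : ∀ μ : ℝ, C < |μ| →
      Dense (Set.range fun x : Kc.domain => Kc x + (μ * Complex.I : ℂ) • (x : H)) := by
    intro μ hμ
    refine dense_closure.1 (hS.mono fun x hx => Metric.mem_closure_iff.2 fun ε hε => ?_)
    obtain ⟨y, hy⟩ := happrox μ hμ ⟨x, hx⟩ ε hε
    refine ⟨_, ⟨⟨y, hKmem y⟩, rfl⟩, ?_⟩
    rw [dist_comm, dist_eq_norm]
    dsimp only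
    rw [hKapp]
    exact (hNpow m _).trans_lt hy
  have hres : ∀ μ : ℝ, C < |μ| → 0 < |μ| → ∃ B : H →L[ℂ] H,
      (∀ z, ∃ h : B z ∈ Kc.domain, Kc ⟨B z, h⟩ + (μ * Complex.I : ℂ) • B z = z) ∧
      (∀ x : Kc.domain, B (Kc x + (μ * Complex.I : ℂ) • (x : H)) = x) ∧
      PMapCommute B T.toLinearPMap.closure := by
    intro μ hμ hμ0
    obtain ⟨B, hB, hB'⟩ := hKc.closure_isClosed.exists_inverse_add_smul (μ * Complex.I) hμ0
      (hsymm.mul_norm_le μ) (hdense μ hμ)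
    refine ⟨B, hB, hB', PMapCommute.closure hTc fun x => ?_⟩
    have hBS : ∀ y : S, B ((K y + (μ * Complex.I : ℂ) • y : S) : H) = y := fun y => by
      have := hB' ⟨y, hKmem y⟩
      rwa [hKapp] at this
    change S at x
    refine Metric.mem_closure_iff.2 fun ε hε => ?_
    obtain ⟨y, hy⟩ := happrox μ hμ x (ε / (1 + |c|)) (by positivity)
    set w := K y + (μ * Complex.I : ℂ) • y with hw
    have hTw : T w = K (T y) + (μ * Complex.I : ℂ) • T y := by
      rw [hw, map_add, map_smul, hKT]
    refine ⟨((w : H), (T w : H)), ?_, ?_⟩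
    · change (B (w : H), B (T w : H)) ∈ T.toLinearPMap.graph
      rw [hTw, hBS, hBS]
      exact T.toLinearPMap.mem_graph y
    · have h1 : ‖(N ^ m) (w - x)‖ * (1 + |c|) < ε := (lt_div_iff₀ (by positivity)).1 hy
      have h2 : 0 ≤ ‖(N ^ m) (w - x)‖ * |c| := by positivity
      have h3 : c * ‖(N ^ m) (w - x)‖ ≤ |c| * ‖(N ^ m) (w - x)‖ := by
        gcongr; exact le_abs_self c
      rw [dist_comm, Prod.dist_eq]
      refine max_lt ?_ ?_
      · have : dist (w : H) x = ‖w - x‖ := dist_eq_norm _ _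
        refine this.trans_lt ?_
        have := hNpow m (w - x)
        linarith
      · have : dist (T w : H) (T x : S) = ‖T (w - x)‖ := by
          rw [map_sub]; exact dist_eq_norm _ _
        refine this.trans_lt ?_
        have := hT (w - x)
        have := norm_nonneg ((N ^ m) (w - x))
        linarith
  set μ : ℝ := |C| + 1 with hμ_def
  have hμ0 : 0 < μ := by positivity
  have hμ : C < |μ| := by
    rw [abs_of_pos hμ0]; linarith [le_abs_self C]
  obtain ⟨B, hB, hB', hBT⟩ := hres μ hμ (abs_pos.2 hμ0.ne')
  obtain ⟨B', hB2, -, hBT'⟩ := hres (-μ) (by rwa [abs_neg]) (by rw [abs_neg]; exact abs_pos.2 hμ0.ne')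
  have hstar : star (μ * Complex.I : ℂ) = ((-μ : ℝ) : ℂ) * Complex.I := by simp
  have hsa : IsSelfAdjoint Kc := by
    refine hsymm.isSelfAdjoint hdom (c := μ * Complex.I) (fun z => ?_) ?_
    · obtain ⟨h, h'⟩ := hB z
      exact ⟨⟨B z, h⟩, h'⟩
    · rw [hstar]
      exact hdense (-μ) (by rwa [abs_neg])
  have hadj : ∀ u v, inner ℂ (B u) v = inner ℂ u (B' v) := fun u v => by
    obtain ⟨hu, hu'⟩ := hB u
    obtain ⟨hv, hv'⟩ := hB2 v
    have e1 := hsymm ⟨_, hu⟩ ⟨_, hv⟩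
    have e2 := congrArg (inner ℂ · (B' v)) hu'
    have e3 := congrArg (inner ℂ (B u) ·) hv'
    simp only [inner_add_left, inner_add_right, inner_smul_left, inner_smul_right] at e2 e3
    rw [← Complex.star_def, hstar] at e2
    linear_combination e2 - e3 - e1
  refine ⟨hsa, fun a ha b hb => ?_⟩
  have hBmem : B ∈ pmapCommutant T.toLinearPMap.closure :=
    ⟨hBT, hBT'.adjoint (hS.mono (LinearPMap.le_closure _).1) hadj⟩
  have haB : ∀ z, a (B z) = B (a z) := fun z => (congrArg (fun L => L z) (ha B hBmem)).symm
  have haK : PMapCommute a Kc := .of_commute_inverse hB hB' haB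
  exact hb a ⟨haK, by rw [← hKc_def, LinearPMap.isSelfAdjoint_def.1 hsa]; exact haK⟩

end StrongCommutation

/-- lemma 4.6 in the paper, after Toledano-Laredo.
Let `D` be a densely defined positive self-adjoint operator on a complex Hilbert space `H`, and
let `H^∞ = ⋂ₙ dom (1+D)ⁿ` be its subspace of smooth vectors.  Let `K, T` be closable operators
with common domain `H^∞` such that `K H^∞ ⊆ H^∞`, `T H^∞ ⊆ H^∞`, `K` is symmetric,
`K T ξ = T K ξ` on `H^∞`, and the energy bounds (d) hold.  Then the closure of `K` is
self-adjoint, and `T` and `K` commute strongly. -/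
theorem statement0
    (D : H →ₗ.[ℂ] H)
    (hDdense : Dense (D.domain : Set H))
    (hDsa : IsSelfAdjoint D)
    (hDpos : ∀ ξ : D.domain, 0 ≤ (inner (𝕜 := ℂ) (ξ : H) (D ξ)).re ∧
        (inner (𝕜 := ℂ) (ξ : H) (D ξ)).im = 0)
    (K T : H →ₗ.[ℂ] H)
    (hKclosable : K.IsClosable) (hTclosable : T.IsClosable)
    (hKdom : (K.domain : Set H) = smoothSet D)
    (hTdom : (T.domain : Set H) = smoothSet D)
    -- (a) invariance of the smooth subspace
    (hKinv : ∀ ξ : K.domain, K ξ ∈ smoothSet D)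
    (hTinv : ∀ ξ : T.domain, T ξ ∈ smoothSet D)
    -- (b) `K` is symmetric
    (hKsymm : ∀ ξ η : K.domain, inner (𝕜 := ℂ) (K ξ) (η : H) =
        inner (𝕜 := ℂ) (ξ : H) (K η))
    -- (c) `K T = T K` on `H^∞`
    (hKT : ∀ (ξ : H) (hξK : ξ ∈ K.domain) (hξT : ξ ∈ T.domain)
        (h₁ : T ⟨ξ, hξT⟩ ∈ K.domain) (h₂ : K ⟨ξ, hξK⟩ ∈ T.domain),
        K ⟨T ⟨ξ, hξT⟩, h₁⟩ = T ⟨K ⟨ξ, hξK⟩, h₂⟩)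
    -- (d) energy bounds
    (hbounds : ∃ m : ℕ, ∀ n : ℕ, ∃ c₁ c₂ c₃ : ℝ, 0 ≤ c₁ ∧ 0 ≤ c₂ ∧ 0 ≤ c₃ ∧
        ∀ (ξ : H) (_ : ξ ∈ smoothSet D)
          (hξK : ξ ∈ K.domain) (hξT : ξ ∈ T.domain) (hξD : ξ ∈ D.domain)
          (hKD : K ⟨ξ, hξK⟩ ∈ D.domain) (hDK : D ⟨ξ, hξD⟩ ∈ K.domain),
          ‖iterApp D.onePlus n (K ⟨ξ, hξK⟩)‖ ≤ c₁ * ‖iterApp D.onePlus (n + 1) ξ‖ ∧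
          ‖iterApp D.onePlus n (D ⟨K ⟨ξ, hξK⟩, hKD⟩ - K ⟨D ⟨ξ, hξD⟩, hDK⟩)‖ ≤
            c₂ * ‖iterApp D.onePlus (n + 1) ξ‖ ∧
          ‖iterApp D.onePlus n (T ⟨ξ, hξT⟩)‖ ≤ c₃ * ‖iterApp D.onePlus (n + m) ξ‖) :
    IsSelfAdjoint K.closure ∧ StronglyCommutes T K := by
  obtain ⟨m, hb⟩ := hbounds
  have hpos : ∀ ξ : D.domain, 0 ≤ (inner (𝕜 := ℂ) (ξ : H) (D ξ)).re := fun ξ => (hDpos ξ).1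
  have hDsymm : D.IsFormalAdjoint D := by
    have := LinearPMap.adjoint_isFormalAdjoint hDdense
    rwa [LinearPMap.isSelfAdjoint_def.1 hDsa] at this
  obtain ⟨R, hRsa, hRd, hR⟩ := exists_inverse_onePlus hDdense hDsa hpos
  have hmemK : ∀ {x : H}, x ∈ K.domain ↔ x ∈ smoothSet D := fun {x} => by
    rw [← hKdom]; rfl
  have hdomeq : T.domain = K.domain := SetLike.coe_injective (hTdom.trans hKdom.symm)
  have hSD : K.domain ≤ D.domain := fun x hx => mem_domain_of_mem_smoothSet (hmemK.1 hx)
  have hS : Dense (K.domain : Set H) := by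
    rw [hKdom]
    refine (dense_setOf_forall_mem_range_pow hRsa hRd).mono fun y hy n => ?_
    obtain ⟨u, rfl⟩ := hy n
    exact inIterDom_pow_apply hR n u
  let N' : Module.End ℂ K.domain :=
    (D.onePlus.toFun ∘ₗ Submodule.inclusion hSD).codRestrict K.domain fun x =>
      hmemK.2 (onePlus_mem_smoothSet (hmemK.1 x.2) _)
  let K' : Module.End ℂ K.domain := K.toFun.codRestrict K.domain fun x => hmemK.2 (hKinv x)
  let T' : Module.End ℂ K.domain :=
    (T.toFun ∘ₗ Submodule.inclusion hdomeq.ge).codRestrict K.domain fun x => hmemK.2 (hTinv _)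
  have hTeq : T = T'.toLinearPMap :=
    LinearPMap.ext hdomeq fun _ _ _ => rfl
  have hNapp : ∀ x : K.domain, (N' x : H) = (x : H) + D ⟨x, hSD x.2⟩ := fun x => rfl
  have hiter : ∀ (n : ℕ) (x : K.domain), iterApp D.onePlus n (x : H) = (N' ^ n) x := by
    intro n
    induction n with
    | zero => exact fun x => rfl
    | succ n ih =>
      intro x
      rw [pow_succ, Module.End.mul_apply, ← ih (N' x), iterApp]
      exact dif_pos (hSD x.2)
  have hDmem : ∀ x : K.domain, D ⟨x, hSD x.2⟩ ∈ K.domain := fun x => by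
    have : D ⟨x, hSD x.2⟩ = (N' x : H) - x := by rw [hNapp]; abel
    rw [this]; exact K.domain.sub_mem (N' x).2 x.2
  have hcomm : ∀ x : K.domain,
      D ⟨K x, hSD (K' x).2⟩ - K ⟨D ⟨x, hSD x.2⟩, hDmem x⟩ = (N' (K' x) - K' (N' x) : K.domain) := by
    intro x
    have h1 : N' x = x + ⟨D ⟨x, hSD x.2⟩, hDmem x⟩ := Subtype.ext (hNapp x)
    rw [h1, map_add]
    change _ = ((K x : H) + D ⟨K x, hSD (K' x).2⟩) - (K x + K ⟨D ⟨x, hSD x.2⟩, hDmem x⟩)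
    abel
  have hbd : ∀ n : ℕ, ∃ c₁ c₂ c₃ : ℝ, ∀ x : K.domain,
      ‖(N' ^ n) (K' x)‖ ≤ c₁ * ‖(N' ^ (n + 1)) x‖ ∧
      ‖(N' ^ n) (N' (K' x) - K' (N' x))‖ ≤ c₂ * ‖(N' ^ (n + 1)) x‖ ∧
      ‖(N' ^ n) (T' x)‖ ≤ c₃ * ‖(N' ^ (n + m)) x‖ := by
    intro n
    obtain ⟨c₁, c₂, c₃, -, -, -, h⟩ := hb n
    refine ⟨c₁, c₂, c₃, fun x => ?_⟩
    have := h x (hmemK.1 x.2) x.2 (hdomeq.ge x.2) (hSD x.2) (hSD (K' x).2) (hDmem x)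
    rw [hcomm, hiter, hiter, hiter] at this
    have e1 := hiter n (K' x)
    have e2 := hiter n (T' x)
    refine ⟨?_, this.2.1, ?_⟩
    · exact (congrArg norm e1).symm.trans_le this.1
    · exact (congrArg norm e2).symm.trans_le this.2.2
  obtain ⟨_, _, c, hT0⟩ := hbd 0
  have hmain := isSelfAdjoint_closure_and_stronglyCommutes (N := N') (K := K') (T := T') hS
    (fun x y => ?_) (fun y => ?_) (fun x => ?_) hKsymm
    (fun n => ?_) (fun n => ?_) (fun x => ?_) (m := m) (c := c) (fun x => ?_) hKclosable
    (hTeq ▸ hTclosable)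
  · rw [hTeq]; exact hmain
  · change inner ℂ (N' x : H) (y : H) = inner ℂ (x : H) (N' y : H)
    rw [hNapp, hNapp, inner_add_left, inner_add_right]
    exact congrArg _ (hDsymm ⟨x, hSD x.2⟩ ⟨y, hSD y.2⟩)
  · obtain ⟨h, h'⟩ := hR y
    exact ⟨⟨R y, hmemK.2 (mem_smoothSet_of_onePlus h (h'.symm ▸ hmemK.1 y.2))⟩, Subtype.ext h'⟩
  · have := norm_le_norm_onePlus hpos ⟨x, hSD x.2⟩
    rw [one_smul, add_comm] at this
    exact this
  · obtain ⟨c₁, _, _, h⟩ := hbd n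
    exact ⟨c₁, fun x => (h x).1⟩
  · obtain ⟨_, c₂, _, h⟩ := hbd n
    exact ⟨c₂, fun x => (h x).2.1⟩
  · exact Subtype.ext (hKT x x.2 (hdomeq.ge x.2) (T' x).2 (hdomeq.ge (K' x).2))
  · simpa using (hT0 x).2.2

end
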